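/- Let k ∈ ℝ satisfy p(k/λᵐ) ≠ 0 for all integers m ≥ 1. For v₀ ∈ ℂ² define the inward iterates v_n := λ^{−n/2}·B(k/λⁿ)·B(k/λⁿ⁻¹)·…·B(k/λ)·v₀. Then the iteration is Lyapunov regular with the two exponents log((λ−1)/√λ) < 0 < log(√λ), independent of k: there is a one-dimensional complex subspace E(k) ⊂ ℂ² such that for every v₀ ∈ E(k) with v₀ ≠ 0, lim_{n→∞} (1/n)·log‖v_n‖ = log((λ−1)/√λ), while for every v₀ ∈ ℂ² \ E(k), lim_{n→∞} (1/n)·log‖v_n‖ = log(√λ). Moreover the subspaces satisfy the equivariance condition E(k/λ) = B(k/λ)·E(k) for all admissible k. -/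

import Mathlib

open Filter

/-- The Perron–Frobenius eigenvalue `λ = (1+√13)/2` of `M = [[1,1],[3,0]]`. -/
noncomputable def lam : ℝ := (1 + Real.sqrt 13) / 2

/-- `p(k) = e^{2πikλ} + e^{2πik(λ+1)} + e^{2πik(λ+2)}`. -/
noncomputable def pfun (k : ℝ) : ℂ :=
  Complex.exp (((2 * Real.pi * k * lam : ℝ) : ℂ) * Complex.I) +
  Complex.exp (((2 * Real.pi * k * (lam + 1) : ℝ) : ℂ) * Complex.I) +
  Complex.exp (((2 * Real.pi * k * (lam + 2) : ℝ) : ℂ) * Complex.I)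

/-- The Fourier matrix `B(k) = [[1,1],[p(k),0]]`. -/
noncomputable def Bmat (k : ℝ) : Matrix (Fin 2) (Fin 2) ℂ :=
  !![1, 1; pfun k, 0]

/-- The inward matrix product `Binw k n = B(k/λⁿ)·B(k/λⁿ⁻¹)·…·B(k/λ)`. -/
noncomputable def Binw (k : ℝ) : ℕ → Matrix (Fin 2) (Fin 2) ℂ
  | 0 => 1
  | n + 1 => Bmat (k / lam ^ (n + 1)) * Binw k n


lemma lam_sq : lam ^ 2 = lam + 3 := by
  have h : Real.sqrt 13 ^ 2 = 13 := Real.sq_sqrt (by norm_num)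
  unfold lam; nlinarith

lemma lam_gt : 2.3 < lam := by
  have h : (3.6 : ℝ) < Real.sqrt 13 := by
    apply Real.lt_sqrt_of_sq_lt; norm_num
  unfold lam; linarith

lemma lam_lt : lam < 2.31 := by
  have h : Real.sqrt 13 < (3.62 : ℝ) := by
    rw [Real.sqrt_lt' (by norm_num)]; norm_num
  unfold lam; linarith

/-- Coordinate along the Perron–Frobenius eigenvector (up to a constant). -/
noncomputable def alp (w : Fin 2 → ℂ) : ℂ := w 1 + (lam : ℂ) * w 0
/-- Coordinate along the other eigenvector (up to a constant). -/
noncomputable def bet (w : Fin 2 → ℂ) : ℂ := ((lam : ℂ) - 1) * w 0 - w 1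

lemma norm_lam : ‖(lam : ℂ)‖ = lam := by
  rw [Complex.norm_real, Real.norm_eq_abs, abs_of_pos (by linarith [lam_gt])]

lemma norm_lam_sub : ‖(lam : ℂ) - 1‖ = lam - 1 := by
  rw [← Complex.ofReal_one, ← Complex.ofReal_sub, Complex.norm_real, Real.norm_eq_abs,
    abs_of_pos (by linarith [lam_gt])]

lemma norm_one_sub_lam : ‖1 - (lam : ℂ)‖ = lam - 1 := by
  rw [norm_sub_rev, norm_lam_sub]

lemma clam_sq : (lam : ℂ) ^ 2 = lam + 3 := by
  exact_mod_cast congrArg (fun x : ℝ => (x : ℂ)) lam_sq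

lemma w0_le (w : Fin 2 → ℂ) (m : ℝ) (ha : ‖alp w‖ ≤ m) (hb : ‖bet w‖ ≤ m) : ‖w 0‖ ≤ m := by
  have h1 : (((2 * lam - 1 : ℝ)) : ℂ) * w 0 = alp w + bet w := by
    unfold alp bet; push_cast; ring
  have h2 : (2 * lam - 1) * ‖w 0‖ ≤ m + m := by
    calc (2 * lam - 1) * ‖w 0‖ = ‖(((2 * lam - 1 : ℝ)) : ℂ) * w 0‖ := by
          rw [norm_mul, Complex.norm_real, Real.norm_eq_abs, abs_of_pos (by linarith [lam_gt])]
      _ ≤ ‖alp w‖ + ‖bet w‖ := by rw [h1]; exact norm_add_le _ _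
      _ ≤ m + m := add_le_add ha hb
  nlinarith [lam_gt, norm_nonneg (w 0)]

lemma norm_le_max (w : Fin 2 → ℂ) (m : ℝ) (ha : ‖alp w‖ ≤ m) (hb : ‖bet w‖ ≤ m) :
    ‖w‖ ≤ 4 * m := by
  have h0 := w0_le w m ha hb
  have hm : 0 ≤ m := (norm_nonneg _).trans h0
  rw [pi_norm_le_iff_of_nonneg (by linarith)]
  intro i
  fin_cases i
  · simp only [Fin.zero_eta]; linarith
  · have h1 : w 1 = alp w - lam * w 0 := by unfold alp; ring
    have h2 : ‖w 1‖ ≤ ‖alp w‖ + lam * ‖w 0‖ := by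
      rw [h1]; refine (norm_sub_le _ _).trans ?_
      rw [norm_mul, norm_lam]
    simp only [Fin.mk_one]
    nlinarith [lam_lt, lam_gt]

lemma alp_le (w : Fin 2 → ℂ) : ‖alp w‖ ≤ 4 * ‖w‖ := by
  have h0 := norm_le_pi_norm w 0
  have h1 := norm_le_pi_norm w 1
  have : ‖alp w‖ ≤ ‖w 1‖ + lam * ‖w 0‖ := by
    unfold alp; refine (norm_add_le _ _).trans ?_
    rw [norm_mul, norm_lam]
  nlinarith [lam_lt, lam_gt, norm_nonneg (w 0)]

lemma bet_le (w : Fin 2 → ℂ) : ‖bet w‖ ≤ 4 * ‖w‖ := by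
  have h0 := norm_le_pi_norm w 0
  have h1 := norm_le_pi_norm w 1
  have : ‖bet w‖ ≤ (lam - 1) * ‖w 0‖ + ‖w 1‖ := by
    unfold bet; refine (norm_sub_le _ _).trans ?_
    rw [norm_mul, norm_lam_sub]
  nlinarith [lam_lt, lam_gt, norm_nonneg (w 0)]

lemma alp_step (x : ℝ) (w : Fin 2 → ℂ) :
    alp ((Bmat x).mulVec w) = lam * alp w + (pfun x - 3) * w 0 := by
  simp [alp, Bmat, Matrix.mulVec, dotProduct, Fin.sum_univ_two]
  linear_combination (-(w 0)) * clam_sq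

lemma bet_step (x : ℝ) (w : Fin 2 → ℂ) :
    bet ((Bmat x).mulVec w) = (1 - lam) * bet w - (pfun x - 3) * w 0 := by
  simp [bet, Bmat, Matrix.mulVec, dotProduct, Fin.sum_univ_two]
  linear_combination (w 0) * clam_sq

lemma pfun_cont : Continuous pfun := by
  unfold pfun; fun_prop

lemma pfun_zero : pfun 0 = 3 := by
  simp [pfun]; norm_num

lemma eps_tendsto (k : ℝ) :
    Tendsto (fun n : ℕ => ‖pfun (k / lam ^ (n + 1)) - 3‖) atTop (nhds 0) := by
  have h1 : Tendsto (fun n : ℕ => k / lam ^ (n + 1)) atTop (nhds 0) := by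
    apply Tendsto.const_div_atTop
    exact (tendsto_pow_atTop_atTop_of_one_lt (by linarith [lam_gt])).comp (tendsto_add_atTop_nat 1)
  have h2 := ((pfun_cont.tendsto 0).comp h1).sub_const 3
  rw [pfun_zero, sub_self] at h2
  simpa using h2.norm

/-- Ratio to rate. -/
lemma rate_of_ratio (x : ℕ → ℂ) (mu : ℂ) (hmu : mu ≠ 0) (e : ℕ → ℝ)
    (he : Tendsto e atTop (nhds 0))
    (hx : ∀ᶠ n in atTop, x n ≠ 0)
    (h : ∀ᶠ n in atTop, ‖x (n + 1) - mu * x n‖ ≤ e n * ‖x n‖) :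
    Tendsto (fun n : ℕ => (n : ℝ)⁻¹ * Real.log ‖x n‖) atTop (nhds (Real.log ‖mu‖)) := by
  have hr : Tendsto (fun n => x (n + 1) / x n) atTop (nhds mu) := by
    rw [tendsto_iff_norm_sub_tendsto_zero]
    refine squeeze_zero' (Eventually.of_forall fun n => norm_nonneg _) ?_ he
    filter_upwards [hx, h] with n hn h1
    have : x (n + 1) / x n - mu = (x (n + 1) - mu * x n) / x n := by field_simp
    rw [this, norm_div, div_le_iff₀ (norm_pos_iff.2 hn)]
    exact h1
  have hl : Tendsto (fun n => Real.log ‖x (n + 1)‖ - Real.log ‖x n‖) atTop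
      (nhds (Real.log ‖mu‖)) := by
    refine ((hr.norm).log (norm_ne_zero_iff.2 hmu)).congr' ?_
    filter_upwards [hx, (tendsto_add_atTop_nat 1).eventually hx] with n hn hn1
    rw [norm_div, Real.log_div (norm_ne_zero_iff.2 hn1) (norm_ne_zero_iff.2 hn)]
  have hc := hl.cesaro
  have h0 : Tendsto (fun n : ℕ => (n : ℝ)⁻¹ * Real.log ‖x 0‖) atTop (nhds 0) := by
    simpa using (tendsto_inv_atTop_nhds_zero_nat (𝕜 := ℝ)).mul_const (Real.log ‖x 0‖)
  have := hc.add h0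
  rw [add_zero] at this
  refine this.congr fun n => ?_
  rw [Finset.sum_range_sub (fun n => Real.log ‖x n‖)]
  ring

lemma rate_compare (x : ℕ → ℂ) (w : ℕ → Fin 2 → ℂ) (l : ℝ)
    (hx : ∀ᶠ n in atTop, x n ≠ 0)
    (h1 : ∀ᶠ n in atTop, ‖w n‖ ≤ 4 * ‖x n‖) (h2 : ∀ n, ‖x n‖ ≤ 4 * ‖w n‖)
    (h : Tendsto (fun n : ℕ => (n : ℝ)⁻¹ * Real.log ‖x n‖) atTop (nhds l)) :
    Tendsto (fun n : ℕ => (n : ℝ)⁻¹ * Real.log ‖w n‖) atTop (nhds l) := by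
  have h0 : Tendsto (fun n : ℕ => (n : ℝ)⁻¹ * Real.log 4) atTop (nhds 0) := by
    simpa using (tendsto_inv_atTop_nhds_zero_nat (𝕜 := ℝ)).mul_const (Real.log 4)
  have hlo := h.sub h0
  have hhi := h.add h0
  rw [sub_zero] at hlo
  rw [add_zero] at hhi
  refine tendsto_of_tendsto_of_tendsto_of_le_of_le' hlo hhi ?_ ?_
  · filter_upwards [hx] with n hn
    have hp := norm_pos_iff.2 hn
    have hw : 0 < ‖w n‖ := by linarith [h2 n]
    have := Real.log_le_log hp (h2 n)
    rw [Real.log_mul (by norm_num) hw.ne'] at this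
    rw [← mul_sub]
    exact mul_le_mul_of_nonneg_left (by linarith) (by positivity)
  · filter_upwards [hx, h1] with n hn h1
    have hp := norm_pos_iff.2 hn
    have hw : 0 < ‖w n‖ := by linarith [h2 n]
    have := Real.log_le_log hw h1
    rw [Real.log_mul (by norm_num) hp.ne'] at this
    rw [← mul_add]
    exact mul_le_mul_of_nonneg_left (by linarith) (by positivity)

lemma Binw_mulVec_succ (k : ℝ) (n : ℕ) (v : Fin 2 → ℂ) :
    (Binw k (n + 1)).mulVec v = (Bmat (k / lam ^ (n + 1))).mulVec ((Binw k n).mulVec v) := by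
  rw [Binw, Matrix.mulVec_mulVec]

lemma Binw_shift (k : ℝ) (n : ℕ) :
    Binw k (n + 1) = Binw (k / lam) n * Bmat (k / lam) := by
  induction n with
  | zero => simp [Binw]
  | succ n ih =>
    rw [Binw, ih, Binw, ← Matrix.mul_assoc]
    congr 3
    rw [div_div, ← pow_succ']

lemma Bmat_unit (x : ℝ) (h : pfun x ≠ 0) : IsUnit (Bmat x) := by
  rw [Matrix.isUnit_iff_isUnit_det, Bmat, Matrix.det_fin_two_of]
  simpa using h

lemma Binw_unit (k : ℝ) (hk : ∀ m : ℕ, 1 ≤ m → pfun (k / lam ^ m) ≠ 0) (n : ℕ) :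
    IsUnit (Binw k n) := by
  induction n with
  | zero => exact isUnit_one
  | succ n ih => exact (Bmat_unit _ (hk _ (by omega))).mul ih

lemma Binw_ne (k : ℝ) (hk : ∀ m : ℕ, 1 ≤ m → pfun (k / lam ^ m) ≠ 0) (n : ℕ)
    (v : Fin 2 → ℂ) (hv : v ≠ 0) : (Binw k n).mulVec v ≠ 0 := by
  intro h
  apply hv
  apply Matrix.mulVec_injective_iff_isUnit.2 (Binw_unit k hk n)
  simpa using h

lemma Binw_surj (k : ℝ) (hk : ∀ m : ℕ, 1 ≤ m → pfun (k / lam ^ m) ≠ 0) (n : ℕ)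
    (w : Fin 2 → ℂ) : ∃ v, (Binw k n).mulVec v = w :=
  Matrix.mulVec_surjective_iff_isUnit.2 (Binw_unit k hk n) w

lemma cone_step (x : ℝ) (w : Fin 2 → ℂ) (hx : ‖pfun x - 3‖ < 1 / 4)
    (h : ‖bet w‖ < ‖alp w‖) :
    ‖bet ((Bmat x).mulVec w)‖ < ‖alp ((Bmat x).mulVec w)‖ := by
  have h0 := w0_le w _ le_rfl h.le
  have ha : lam * ‖alp w‖ - ‖pfun x - 3‖ * ‖w 0‖ ≤ ‖alp ((Bmat x).mulVec w)‖ := by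
    rw [alp_step]
    have := norm_sub_norm_le (lam * alp w) (-((pfun x - 3) * w 0))
    rw [norm_neg, norm_mul, norm_mul, norm_lam, sub_neg_eq_add] at this
    exact this
  have hb : ‖bet ((Bmat x).mulVec w)‖ ≤ (lam - 1) * ‖bet w‖ + ‖pfun x - 3‖ * ‖w 0‖ := by
    rw [bet_step]
    refine (norm_sub_le _ _).trans ?_
    rw [norm_mul, norm_mul, norm_one_sub_lam]
  have h3 : ‖pfun x - 3‖ * ‖w 0‖ ≤ 1 / 4 * ‖alp w‖ := by gcongr
  have h4 : (lam - 1) * ‖bet w‖ ≤ (lam - 1) * ‖alp w‖ := by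
    have := lam_gt
    gcongr
    linarith
  nlinarith [norm_nonneg (bet w)]

/-- from `N` on the cone is invariant -/
lemma exists_N (k : ℝ) : ∃ N : ℕ, ∀ n ≥ N, ∀ v : Fin 2 → ℂ,
    ‖bet ((Binw k n).mulVec v)‖ < ‖alp ((Binw k n).mulVec v)‖ →
    ‖bet ((Binw k (n+1)).mulVec v)‖ < ‖alp ((Binw k (n+1)).mulVec v)‖ := by
  obtain ⟨N, hN⟩ := eventually_atTop.1
    ((eps_tendsto k).eventually (gt_mem_nhds (show (0:ℝ) < 1/4 by norm_num)))
  refine ⟨N, fun n hn v h => ?_⟩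
  rw [Binw_mulVec_succ]
  exact cone_step _ _ (hN n hn) h

lemma rate_fast (k : ℝ) (v : Fin 2 → ℂ)
    (h : ∀ᶠ n in atTop, ‖bet ((Binw k n).mulVec v)‖ < ‖alp ((Binw k n).mulVec v)‖) :
    Tendsto (fun n : ℕ => (n : ℝ)⁻¹ * Real.log ‖(Binw k n).mulVec v‖) atTop
      (nhds (Real.log lam)) := by
  have hne : ∀ᶠ n in atTop, alp ((Binw k n).mulVec v) ≠ 0 := by
    filter_upwards [h] with n hn h0
    rw [h0, norm_zero] at hn
    exact absurd hn (not_lt.2 (norm_nonneg _))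
  apply rate_compare (fun n => alp ((Binw k n).mulVec v)) _ _ hne
  · filter_upwards [h] with n hn
    exact norm_le_max _ _ le_rfl hn.le
  · exact fun n => alp_le _
  have := rate_of_ratio (fun n => alp ((Binw k n).mulVec v)) lam
    (by rw [← norm_ne_zero_iff, norm_lam]; linarith [lam_gt]) _ (eps_tendsto k) hne ?_
  · rwa [norm_lam] at this
  · filter_upwards [h] with n hn
    rw [Binw_mulVec_succ, alp_step, add_sub_cancel_left, norm_mul]
    gcongr
    exact w0_le _ _ le_rfl hn.le

lemma rate_slow (k : ℝ) (hk : ∀ m : ℕ, 1 ≤ m → pfun (k / lam ^ m) ≠ 0)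
    (v : Fin 2 → ℂ) (hv : v ≠ 0)
    (h : ∀ᶠ n in atTop, ‖alp ((Binw k n).mulVec v)‖ ≤ ‖bet ((Binw k n).mulVec v)‖) :
    Tendsto (fun n : ℕ => (n : ℝ)⁻¹ * Real.log ‖(Binw k n).mulVec v‖) atTop
      (nhds (Real.log (lam - 1))) := by
  have hne : ∀ᶠ n in atTop, bet ((Binw k n).mulVec v) ≠ 0 := by
    filter_upwards [h] with n hn h0
    have h1 := norm_le_max _ _ hn le_rfl
    rw [h0, norm_zero, mul_zero] at h1
    exact Binw_ne k hk n v hv (norm_le_zero_iff.1 h1)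
  apply rate_compare (fun n => bet ((Binw k n).mulVec v)) _ _ hne
  · filter_upwards [h] with n hn
    exact norm_le_max _ _ hn le_rfl
  · exact fun n => bet_le _
  have := rate_of_ratio (fun n => bet ((Binw k n).mulVec v)) (1 - lam)
    (by rw [← norm_ne_zero_iff, norm_one_sub_lam]; linarith [lam_gt]) _ (eps_tendsto k) hne ?_
  · rwa [norm_one_sub_lam] at this
  · filter_upwards [h] with n hn
    rw [Binw_mulVec_succ, bet_step, sub_sub_cancel_left, norm_neg, norm_mul]
    gcongr
    exact w0_le _ _ hn le_rfl

lemma dichotomy (k : ℝ) (hk : ∀ m : ℕ, 1 ≤ m → pfun (k / lam ^ m) ≠ 0)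
    (v : Fin 2 → ℂ) (hv : v ≠ 0) :
    Tendsto (fun n : ℕ => (n : ℝ)⁻¹ * Real.log ‖(Binw k n).mulVec v‖) atTop
      (nhds (Real.log lam)) ∨
    Tendsto (fun n : ℕ => (n : ℝ)⁻¹ * Real.log ‖(Binw k n).mulVec v‖) atTop
      (nhds (Real.log (lam - 1))) := by
  obtain ⟨N, hN⟩ := exists_N k
  by_cases hc : ∃ n ≥ N, ‖bet ((Binw k n).mulVec v)‖ < ‖alp ((Binw k n).mulVec v)‖
  · left
    obtain ⟨n, hn, h⟩ := hc
    apply rate_fast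
    filter_upwards [eventually_ge_atTop n] with m hm
    induction m, hm using Nat.le_induction with
    | base => exact h
    | succ m hm ih => exact hN m (hn.trans hm) v ih
  · right
    push Not at hc
    apply rate_slow k hk v hv
    filter_upwards [eventually_ge_atTop N] with m hm using hc m hm

lemma exists_fast (k : ℝ) (hk : ∀ m : ℕ, 1 ≤ m → pfun (k / lam ^ m) ≠ 0) :
    ∃ v : Fin 2 → ℂ,
    Tendsto (fun n : ℕ => (n : ℝ)⁻¹ * Real.log ‖(Binw k n).mulVec v‖) atTop
      (nhds (Real.log lam)) := by
  obtain ⟨N, hN⟩ := exists_N k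
  obtain ⟨v, hv⟩ := Binw_surj k hk N ![1, (lam : ℂ) - 1]
  refine ⟨v, rate_fast k v ?_⟩
  filter_upwards [eventually_ge_atTop N] with m hm
  induction m, hm using Nat.le_induction with
  | base =>
    rw [hv]
    have h1 : bet ![1, (lam : ℂ) - 1] = 0 := by simp [bet]
    rw [h1, norm_zero, norm_pos_iff]
    have h2 : alp ![1, (lam : ℂ) - 1] = ((2 * lam - 1 : ℝ) : ℂ) := by simp [alp]; ring
    rw [h2]
    have h3 : (2 * lam - 1) ≠ 0 := by have := lam_gt; intro h; linarith
    exact_mod_cast h3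
  | succ m hm ih => exact hN m hm v ih

lemma alp_smul (c : ℂ) (w : Fin 2 → ℂ) : alp (c • w) = c * alp w := by
  simp [alp]; ring

lemma bet_smul (c : ℂ) (w : Fin 2 → ℂ) : bet (c • w) = c * bet w := by
  simp [bet]; ring

lemma exists_slow (k : ℝ) (hk : ∀ m : ℕ, 1 ≤ m → pfun (k / lam ^ m) ≠ 0) :
    ∃ v : Fin 2 → ℂ, v ≠ 0 ∧
    Tendsto (fun n : ℕ => (n : ℝ)⁻¹ * Real.log ‖(Binw k n).mulVec v‖) atTop
      (nhds (Real.log (lam - 1))) := by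
  obtain ⟨N, hN⟩ := exists_N k
  let K : ℕ → Set (Fin 2 → ℂ) := fun n => Metric.sphere 0 1 ∩
    {v | ‖alp ((Binw k (N + n)).mulVec v)‖ ≤ ‖bet ((Binw k (N + n)).mulVec v)‖}
  have hcl : ∀ n, IsClosed {v : Fin 2 → ℂ | ‖alp ((Binw k (N + n)).mulVec v)‖ ≤
      ‖bet ((Binw k (N + n)).mulVec v)‖} := by
    intro n
    have hc : Continuous fun v : Fin 2 → ℂ => (Binw k (N + n)).mulVec v :=
      Continuous.matrix_mulVec continuous_const continuous_id
    apply isClosed_le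
    · unfold alp
      fun_prop
    · unfold bet
      fun_prop
  have hK : (⋂ n, K n).Nonempty := by
    apply IsCompact.nonempty_iInter_of_sequence_nonempty_isCompact_isClosed
    · rintro n v ⟨h1, h2⟩
      refine ⟨h1, ?_⟩
      by_contra h3
      simp only [Set.mem_ofPred_eq, not_le] at h2 h3
      exact absurd (hN (N + n) (by omega) v h3) (not_lt.2 h2)
    · intro n
      obtain ⟨v, hv⟩ := Binw_surj k hk (N + n) ![1, -(lam : ℂ)]
      have hv0 : v ≠ 0 := by
        rintro rfl
        have := congrFun hv 0
        simp at this
      refine ⟨((‖v‖⁻¹ : ℝ) : ℂ) • v, ?_, ?_⟩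
      · simp [norm_smul, norm_ne_zero_iff.2 hv0]
      · have h1 : alp ![1, -(lam : ℂ)] = 0 := by simp [alp]
        simp only [Set.mem_ofPred_eq, Matrix.mulVec_smul, hv, alp_smul, h1]
        simp
    · exact (isCompact_sphere _ _).inter_right (hcl 0)
    · intro n
      exact Metric.isClosed_sphere.inter (hcl n)
  obtain ⟨v, hv⟩ := hK
  rw [Set.mem_iInter] at hv
  have hv0 : v ≠ 0 := by
    have := (hv 0).1
    intro h
    simp [h] at this
  refine ⟨v, hv0, rate_slow k hk v hv0 ?_⟩
  filter_upwards [eventually_ge_atTop N] with m hm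
  obtain ⟨j, rfl⟩ := Nat.exists_eq_add_of_le hm
  exact (hv j).2

/-- The slow subspace. -/
noncomputable def Esub (k : ℝ) : Submodule ℂ (Fin 2 → ℂ) where
  carrier := {v | Tendsto (fun n : ℕ => ((2 : ℂ)⁻¹ ^ n) • (Binw k n).mulVec v) atTop (nhds 0)}
  add_mem' := by
    intro a b ha hb
    have := Tendsto.add ha hb
    rw [add_zero] at this
    refine this.congr fun n => ?_
    rw [Matrix.mulVec_add, smul_add]
  zero_mem' := by simp
  smul_mem' := by
    intro c v hv
    have := Tendsto.const_smul hv c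
    rw [smul_zero] at this
    refine this.congr fun n => ?_
    rw [Matrix.mulVec_smul, smul_comm]

lemma mem_Esub (k : ℝ) (v : Fin 2 → ℂ) : v ∈ Esub k ↔
    Tendsto (fun n : ℕ => ((2 : ℂ)⁻¹ ^ n) • (Binw k n).mulVec v) atTop (nhds 0) := Iff.rfl

lemma mem_Esub' (k : ℝ) (v : Fin 2 → ℂ) : v ∈ Esub k ↔
    Tendsto (fun n : ℕ => ((2 : ℝ)⁻¹ ^ n) * ‖(Binw k n).mulVec v‖) atTop (nhds 0) := by
  rw [mem_Esub, tendsto_zero_iff_norm_tendsto_zero]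
  simp only [norm_smul, norm_pow, norm_inv, Complex.norm_ofNat]

lemma not_mem_of_fast (k : ℝ) (v : Fin 2 → ℂ)
    (h : Tendsto (fun n : ℕ => (n : ℝ)⁻¹ * Real.log ‖(Binw k n).mulVec v‖) atTop
      (nhds (Real.log lam))) : v ∉ Esub k := by
  rw [mem_Esub']
  intro h0
  have h1 := h.eventually (lt_mem_nhds
    (Real.log_lt_log (by norm_num) (by linarith [lam_gt] : (2:ℝ) < lam)))
  have h2 := h0.eventually (gt_mem_nhds (show (0:ℝ) < 1 by norm_num))
  obtain ⟨n, h1, h2, hn⟩ := (h1.and (h2.and (eventually_gt_atTop 0))).exists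
  have hn' : (0:ℝ) < n := by exact_mod_cast hn
  rw [inv_mul_eq_div, lt_div_iff₀ hn', mul_comm, ← Real.log_pow] at h1
  rw [inv_pow, inv_mul_eq_div, div_lt_one (by positivity)] at h2
  have hpos : 0 < ‖(Binw k n).mulVec v‖ := by
    rcases (norm_nonneg ((Binw k n).mulVec v)).eq_or_lt with h3 | h3
    · rw [← h3, Real.log_zero] at h1
      have : 0 ≤ Real.log ((2:ℝ) ^ n) := Real.log_nonneg (one_le_pow₀ (by norm_num))
      linarith
    · exact h3
  have := Real.log_le_log hpos h2.le
  linarith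

lemma mem_of_slow (k : ℝ) (v : Fin 2 → ℂ)
    (h : Tendsto (fun n : ℕ => (n : ℝ)⁻¹ * Real.log ‖(Binw k n).mulVec v‖) atTop
      (nhds (Real.log (lam - 1)))) : v ∈ Esub k := by
  rw [mem_Esub']
  have h1 := h.eventually (gt_mem_nhds
    (Real.log_lt_log (by linarith [lam_gt]) (by linarith [lam_lt] : lam - 1 < 3 / 2)))
  have h2 : Tendsto (fun n : ℕ => ((3:ℝ) / 4) ^ n) atTop (nhds 0) :=
    tendsto_pow_atTop_nhds_zero_of_lt_one (by norm_num) (by norm_num)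
  refine squeeze_zero' (Eventually.of_forall fun n => by positivity) ?_ h2
  filter_upwards [h1, eventually_gt_atTop 0] with n h1 hn
  have hn' : (0:ℝ) < n := by exact_mod_cast hn
  rw [inv_mul_eq_div, div_lt_iff₀ hn', mul_comm, ← Real.log_pow] at h1
  have h3 : ‖(Binw k n).mulVec v‖ ≤ (3 / 2) ^ n := by
    rcases (norm_nonneg ((Binw k n).mulVec v)).eq_or_lt with h3 | h3
    · rw [← h3]; positivity
    · exact ((Real.log_lt_log_iff h3 (by positivity)).1 h1).le
  calc (2:ℝ)⁻¹ ^ n * ‖(Binw k n).mulVec v‖ ≤ (2:ℝ)⁻¹ ^ n * (3 / 2) ^ n := by gcongr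
    _ = (3 / 4) ^ n := by rw [← mul_pow]; norm_num

lemma scale_rate (k : ℝ) (hk : ∀ m : ℕ, 1 ≤ m → pfun (k / lam ^ m) ≠ 0)
    (v : Fin 2 → ℂ) (hv : v ≠ 0) (l : ℝ)
    (h : Tendsto (fun n : ℕ => (n : ℝ)⁻¹ * Real.log ‖(Binw k n).mulVec v‖) atTop
      (nhds l)) :
    Tendsto (fun n : ℕ =>
      (n : ℝ)⁻¹ * Real.log ‖((Real.sqrt lam)⁻¹ ^ n) • (Binw k n).mulVec v‖)
      atTop (nhds (l - Real.log (Real.sqrt lam))) := by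
  refine (h.sub_const _).congr' ?_
  filter_upwards [eventually_gt_atTop 0] with n hn
  have hs : 0 < Real.sqrt lam := Real.sqrt_pos.2 (by linarith [lam_gt])
  have hn' : (n:ℝ) ≠ 0 := by exact_mod_cast hn.ne'
  rw [norm_smul, Real.log_mul (norm_ne_zero_iff.2 (by positivity)) (norm_ne_zero_iff.2 (Binw_ne k hk n v hv)),
    Real.norm_of_nonneg (by positivity), Real.log_pow, Real.log_inv]
  field_simp
  ring

lemma Esub_map (k : ℝ) (hk : ∀ m : ℕ, 1 ≤ m → pfun (k / lam ^ m) ≠ 0) :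
    Esub (k / lam) = Submodule.map (Matrix.mulVecLin (Bmat (k / lam))) (Esub k) := by
  have hiff : ∀ v, (Bmat (k / lam)).mulVec v ∈ Esub (k / lam) ↔ v ∈ Esub k := by
    intro v
    rw [mem_Esub', mem_Esub', ← tendsto_add_atTop_iff_nat
      (f := fun n : ℕ => ((2 : ℝ)⁻¹ ^ n) * ‖(Binw k n).mulVec v‖) 1]
    simp only [Binw_shift, ← Matrix.mulVec_mulVec]
    constructor
    · intro h
      have := h.const_mul (2⁻¹ : ℝ)
      rw [mul_zero] at this
      exact this.congr fun n => by ring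
    · intro h
      have := h.const_mul (2 : ℝ)
      rw [mul_zero] at this
      exact this.congr fun n => by ring
  have hu : IsUnit (Bmat (k / lam)) := by
    apply Bmat_unit
    simpa using hk 1 le_rfl
  ext w
  rw [Submodule.mem_map]
  constructor
  · intro hw
    obtain ⟨v, rfl⟩ := Matrix.mulVec_surjective_iff_isUnit.2 hu w
    exact ⟨v, (hiff v).1 hw, rfl⟩
  · rintro ⟨v, hv, rfl⟩
    exact (hiff v).2 hv

/-- For admissible `k` (i.e. `p(k/λᵐ) ≠ 0` for all `m ≥ 1`), the inward iteration
`v_n := λ^{−n/2}·B(k/λⁿ)·…·B(k/λ)·v₀` is Lyapunov regular with the two exponents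
`log((λ−1)/√λ) < 0 < log √λ`, independent of `k`: there is a one-dimensional complex
subspace `E(k) ⊂ ℂ²` such that nonzero `v₀ ∈ E(k)` give exponent `log((λ−1)/√λ)` and
`v₀ ∉ E(k)` give exponent `log √λ`; moreover `E(k/λ) = B(k/λ)·E(k)` for admissible `k`. -/
theorem stmt7 :
    Real.log ((lam - 1) / Real.sqrt lam) < 0 ∧ 0 < Real.log (Real.sqrt lam) ∧
    ∃ E : ℝ → Submodule ℂ (Fin 2 → ℂ),
      ∀ k : ℝ, (∀ m : ℕ, 1 ≤ m → pfun (k / lam ^ m) ≠ 0) →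
        Module.finrank ℂ (E k) = 1 ∧
        (∀ v₀ ∈ E k, v₀ ≠ 0 →
          Tendsto (fun n : ℕ =>
              (n : ℝ)⁻¹ * Real.log ‖((Real.sqrt lam)⁻¹ ^ n) • (Binw k n).mulVec v₀‖)
            atTop (nhds (Real.log ((lam - 1) / Real.sqrt lam)))) ∧
        (∀ v₀ : Fin 2 → ℂ, v₀ ∉ E k →
          Tendsto (fun n : ℕ =>
              (n : ℝ)⁻¹ * Real.log ‖((Real.sqrt lam)⁻¹ ^ n) • (Binw k n).mulVec v₀‖)
            atTop (nhds (Real.log (Real.sqrt lam)))) ∧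
        E (k / lam) = Submodule.map (Matrix.mulVecLin (Bmat (k / lam))) (E k) := by
  have hl := lam_gt
  have hl0 : 0 < lam := by linarith
  have hs : 0 < Real.sqrt lam := Real.sqrt_pos.2 hl0
  have hs2 : Real.sqrt lam * Real.sqrt lam = lam := Real.mul_self_sqrt hl0.le
  have h1s : 1 < Real.sqrt lam := by nlinarith
  have hlog : Real.log lam = Real.log (Real.sqrt lam) + Real.log (Real.sqrt lam) := by
    rw [← Real.log_mul hs.ne' hs.ne', hs2]
  refine ⟨?_, Real.log_pos h1s, Esub, ?_⟩
  · apply Real.log_neg (div_pos (by linarith) hs)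
    rw [div_lt_one hs]
    have := lam_lt
    nlinarith
  intro k hk
  refine ⟨?_, ?_, ?_, Esub_map k hk⟩
  · obtain ⟨v, hv⟩ := exists_fast k hk
    obtain ⟨u, hu0, hu⟩ := exists_slow k hk
    have h1 : Module.finrank ℂ (Esub k) < 2 := by
      have := Submodule.finrank_lt (s := Esub k)
        (fun h => not_mem_of_fast k v hv (h ▸ Submodule.mem_top))
      simpa using this
    have h2 : 0 < Module.finrank ℂ (Esub k) := by
      rw [Module.finrank_pos_iff, Submodule.nontrivial_iff_ne_bot, Submodule.ne_bot_iff]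
      exact ⟨u, mem_of_slow k u hu, hu0⟩
    omega
  · intro v hv hv0
    rcases dichotomy k hk v hv0 with h | h
    · exact absurd hv (not_mem_of_fast k v h)
    · rw [Real.log_div (by linarith) hs.ne']
      exact scale_rate k hk v hv0 _ h
  · intro v hv
    have hv0 : v ≠ 0 := by
      rintro rfl
      exact hv (Submodule.zero_mem _)
    rcases dichotomy k hk v hv0 with h | h
    · have := scale_rate k hk v hv0 _ h
      rwa [hlog, add_sub_cancel_right] at this
    · exact absurd (mem_of_slow k v h) hv
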